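/- Let r ≥ 3 and ℓ ≥ 2, and let G be the graph obtained from the complete graph K^r on vertices u_1, ..., u_r by deleting the edge u_1u_2 and adding a path of length ℓ from u_1 to u_2 through ℓ - 1 new vertices. Then G is M(K_{1,r})-saturated. -/

import Mathlib

/-- `H.IsMinorOf G` : `H` is a minor of `G`, via the branch-set (model) definition:
there are pairwise disjoint nonempty connected subsets of `V(G)`, one for each vertex
of `H`, with an edge of `G` between the branch sets corresponding to each edge of `H`. -/
def SimpleGraph.IsMinorOf {W V : Type*} (H : SimpleGraph W) (G : SimpleGraph V) : Prop :=
  ∃ B : W → Set V,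
    (∀ w, (B w).Nonempty) ∧
    (∀ w, (G.induce (B w)).Connected) ∧
    (Pairwise fun w₁ w₂ => Disjoint (B w₁) (B w₂)) ∧
    ∀ ⦃w₁ w₂⦄, H.Adj w₁ w₂ → ∃ v₁ ∈ B w₁, ∃ v₂ ∈ B w₂, G.Adj v₁ v₂

/-- The graph `G + uv` obtained from `G` by adding the edge `uv`. -/
def SimpleGraph.addEdge {V : Type*} (G : SimpleGraph V) (u v : V) : SimpleGraph V :=
  G ⊔ SimpleGraph.fromEdgeSet {s(u, v)}

/-- `G` is `M(H)`-saturated: `G` has no `H`-minor, but adding any edge between two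
distinct non-adjacent vertices creates an `H`-minor. -/
def MinorSaturated {W V : Type*} (H : SimpleGraph W) (G : SimpleGraph V) : Prop :=
  ¬ H.IsMinorOf G ∧
    ∀ u v : V, u ≠ v → ¬ G.Adj u v → H.IsMinorOf (G.addEdge u v)

/-- The graph obtained from the complete graph `K^r` (on `Fin r`, with `u₁ = 0` and
`u₂ = 1`) by deleting the edge `u₁u₂` and adding a path of length `ℓ` from `u₁` to `u₂`
through `ℓ - 1` new vertices `p_0, …, p_{ℓ-2}` (so `u₁ ~ p_0`, `p_i ~ p_{i+1}`, and
`p_{ℓ-2} ~ u₂`). -/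
def pathReplacedComplete (r ℓ : ℕ) : SimpleGraph (Fin r ⊕ Fin (ℓ - 1)) :=
  SimpleGraph.fromRel fun a b =>
    match a, b with
    | Sum.inl i, Sum.inl j => ¬(i.val = 0 ∧ j.val = 1) ∧ ¬(i.val = 1 ∧ j.val = 0)
    | Sum.inl i, Sum.inr p => (i.val = 0 ∧ p.val = 0) ∨ (i.val = 1 ∧ p.val = ℓ - 2)
    | Sum.inr p, Sum.inr q => q.val = p.val + 1
    | Sum.inr _, Sum.inl _ => False

namespace SimpleGraph

/-- A connected set that meets a set `S` and has no edge leaving `S` lies inside `S`. -/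
theorem mem_of_induce_connected {V : Type*} {G : SimpleGraph V} {C : Set V}
    (hC : (G.induce C).Connected) (S : Set V)
    (hS : ∀ a ∈ C, ∀ b ∈ C, a ∈ S → G.Adj a b → b ∈ S)
    {x y : V} (hx : x ∈ C) (hxS : x ∈ S) (hy : y ∈ C) : y ∈ S := by
  obtain ⟨p⟩ := hC.preconnected ⟨x, hx⟩ ⟨y, hy⟩
  have key : ∀ {a b : C}, (G.induce C).Walk a b → (a : V) ∈ S → (b : V) ∈ S := by
    intro a b p
    induction p with
    | nil => exact id
    | cons h _ ih => exact fun ha => ih (hS _ (Subtype.prop _) _ (Subtype.prop _) ha h)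
  exact key p hxS

/-- The vertices outside `C` that are adjacent to some vertex of `C`. -/
def outerBoundary {V : Type*} (G : SimpleGraph V) (C : Set V) : Set V :=
  {a | a ∉ C ∧ ∃ c ∈ C, G.Adj c a}

/-- A graph has a `K_{1,r}` minor if and only if some connected set has at least `r` vertices in
its outer boundary. -/
theorem star_isMinorOf_iff {V : Type*} {G : SimpleGraph V} {r : ℕ} :
    (completeBipartiteGraph (Fin 1) (Fin r)).IsMinorOf G ↔
      ∃ C : Set V, (G.induce C).Connected ∧
        ∃ f : Fin r → V, Function.Injective f ∧ ∀ j, f j ∈ G.outerBoundary C := by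
  constructor
  · rintro ⟨B, -, hconn, hdisj, hadj⟩
    have h (j : Fin r) : ∃ a ∈ B (Sum.inr j), a ∈ G.outerBoundary (B (Sum.inl 0)) := by
      obtain ⟨c, hc, a, ha, hca⟩ := hadj (w₁ := Sum.inl 0) (w₂ := Sum.inr j) (by simp)
      exact ⟨a, ha, fun h => Set.disjoint_left.1 (hdisj Sum.inl_ne_inr) h ha, c, hc, hca⟩
    choose f hfB hf using h
    refine ⟨_, hconn (Sum.inl 0), f, fun i j hij => ?_, hf⟩
    by_contra hne
    exact Set.disjoint_left.1 (hdisj (Sum.inr_injective.ne hne)) (hfB i) (hij ▸ hfB j)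
  · rintro ⟨C, hC, f, hf, hfC⟩
    refine ⟨Sum.elim (fun _ => C) (fun j => {f j}), ?_, ?_, ?_, ?_⟩
    · rintro (_ | j)
      · exact Set.nonempty_coe_sort.1 hC.nonempty
      · simp
    · rintro (_ | j)
      · exact hC
      · simp
    · rintro (i | i) (j | j) hij
      · exact absurd (congrArg Sum.inl (Subsingleton.elim i j)) hij
      · simpa using (hfC j).1
      · simpa using (hfC i).1
      · simpa using fun h => hij (congrArg Sum.inr (hf h.symm).symm)
    · rintro (i | i) (j | j) hij
      · simp at hij
      · obtain ⟨c, hc, h⟩ := (hfC j).2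
        exact ⟨c, hc, f j, rfl, h⟩
      · obtain ⟨c, hc, h⟩ := (hfC i).2
        exact ⟨f i, rfl, c, hc, h.symm⟩
      · simp at hij

theorem addEdge_adj {V : Type*} {G : SimpleGraph V} {u v a b : V} :
    (G.addEdge u v).Adj a b ↔ G.Adj a b ∨ (s(u, v) = s(a, b) ∧ a ≠ b) := by
  simp [addEdge, eq_comm]

theorem addEdge_comm {V : Type*} (G : SimpleGraph V) (u v : V) :
    G.addEdge u v = G.addEdge v u := by
  rw [addEdge, addEdge, Sym2.eq_swap]

end SimpleGraph

namespace pathReplacedComplete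

open SimpleGraph

variable {r ℓ : ℕ}

/-- The vertices of the complete graph other than the two ends of the path. -/
def IsHub (v : Fin r ⊕ Fin (ℓ - 1)) : Prop :=
  Sum.elim (fun i => 2 ≤ i.val) (fun _ => False) v

/-- The distance from `u₁` along the path, for vertices on the path. -/
def pos (v : Fin r ⊕ Fin (ℓ - 1)) : ℕ :=
  Sum.elim (fun i => if i.val = 0 then 0 else ℓ) (fun p => p.val + 1) v

variable {a b c x y : Fin r ⊕ Fin (ℓ - 1)}

theorem adj_of_isHub (ha : IsHub a) (hb : IsHub b) :
    (pathReplacedComplete r ℓ).Adj a b ↔ a ≠ b := by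
  rcases a with a | a <;> rcases b with b | b <;>
    simp_all [IsHub, pathReplacedComplete]
  grind

theorem adj_of_isHub_of_not_isHub (hℓ : 2 ≤ ℓ) (ha : IsHub a) (hb : ¬ IsHub b) :
    (pathReplacedComplete r ℓ).Adj a b ↔ pos b = 0 ∨ pos b = ℓ := by
  rcases a with a | a <;> rcases b with b | b <;>
    simp_all [IsHub, pos, pathReplacedComplete] <;> grind

theorem adj_of_not_isHub (hℓ : 2 ≤ ℓ) (ha : ¬ IsHub a) (hb : ¬ IsHub b) :
    (pathReplacedComplete r ℓ).Adj a b ↔ pos a + 1 = pos b ∨ pos b + 1 = pos a := by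
  rcases a with a | a <;> rcases b with b | b <;>
    simp_all [IsHub, pos, pathReplacedComplete] <;> grind

theorem pos_le (hℓ : 2 ≤ ℓ) : pos a ≤ ℓ := by
  rcases a with a | a <;> simp only [pos, Sum.elim_inl, Sum.elim_inr]
  · split_ifs <;> omega
  · omega

theorem eq_of_pos_eq (hℓ : 2 ≤ ℓ) (ha : ¬ IsHub a) (hb : ¬ IsHub b) (h : pos a = pos b) :
    a = b := by
  rcases a with a | a <;> rcases b with b | b <;> simp_all [IsHub, pos] <;> grind

theorem exists_pos_eq (hr : 3 ≤ r) (hℓ : 2 ≤ ℓ) {n : ℕ} (hn : n ≤ ℓ) :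
    ∃ v : Fin r ⊕ Fin (ℓ - 1), ¬ IsHub v ∧ pos v = n := by
  rcases Nat.eq_zero_or_pos n with rfl | h0
  · exact ⟨Sum.inl ⟨0, by omega⟩, by simp [IsHub], by simp [pos]⟩
  rcases hn.eq_or_lt with rfl | hlt
  · exact ⟨Sum.inl ⟨1, by omega⟩, by simp [IsHub], by simp [pos]⟩
  · exact ⟨Sum.inr ⟨n - 1, by omega⟩, by simp [IsHub], by simp [pos]; omega⟩

variable {C : Set (Fin r ⊕ Fin (ℓ - 1))}

/-- A connected set inside the path that avoids a path vertex stays on one side of it. -/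
theorem pos_lt_of_pos_lt (hℓ : 2 ≤ ℓ) (hC : ((pathReplacedComplete r ℓ).induce C).Connected)
    (hub : ∀ v ∈ C, ¬ IsHub v) (ha : ¬ IsHub a) (haC : a ∉ C) (hx : x ∈ C) (hy : y ∈ C)
    (hxa : pos x < pos a) : pos y < pos a := by
  refine mem_of_induce_connected hC {v | pos v < pos a} ?_ hx hxa hy
  intro v hv w hw hva hvw
  rw [adj_of_not_isHub hℓ (hub v hv) (hub w hw)] at hvw
  have : pos w ≠ pos a := fun h => haC (eq_of_pos_eq hℓ (hub w hw) ha h ▸ hw)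
  simp only [Set.mem_ofPred_eq] at *
  omega

theorem pos_mem_Ioo (hℓ : 2 ≤ ℓ) (hC : ((pathReplacedComplete r ℓ).induce C).Connected)
    (hub : ∀ v ∈ C, ¬ IsHub v) (ha : ¬ IsHub a) (hb : ¬ IsHub b)
    (haN : a ∈ (pathReplacedComplete r ℓ).outerBoundary C)
    (hbN : b ∈ (pathReplacedComplete r ℓ).outerBoundary C)
    (hab : pos a < pos b) (hx : x ∈ C) : pos x ∈ Set.Ioo (pos a) (pos b) := by
  obtain ⟨haC, d, hd, hda⟩ := haN
  obtain ⟨hbC, e, he, heb⟩ := hbN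
  rw [adj_of_not_isHub hℓ (hub _ hd) ha] at hda
  rw [adj_of_not_isHub hℓ (hub _ he) hb] at heb
  have ne {v w} (hv : v ∈ C) (hw : ¬ IsHub w) (hwC : w ∉ C) : pos v ≠ pos w :=
    fun h => hwC (eq_of_pos_eq hℓ (hub v hv) hw h ▸ hv)
  have h1 := ne hx ha haC
  have h2 := ne hd hb hbC
  have h3 := ne he ha haC
  have h4 := pos_lt_of_pos_lt hℓ hC hub ha haC hx he
  have h5 := pos_lt_of_pos_lt hℓ hC hub hb hbC hd hx
  constructor <;> omega

theorem not_mem_outerBoundary_between (hℓ : 2 ≤ ℓ)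
    (hC : ((pathReplacedComplete r ℓ).induce C).Connected)
    (ha : ¬ IsHub a) (hb : ¬ IsHub b) (hc : ¬ IsHub c)
    (haN : a ∈ (pathReplacedComplete r ℓ).outerBoundary C)
    (hcN : c ∈ (pathReplacedComplete r ℓ).outerBoundary C)
    (hab : pos a < pos b) (hbc : pos b < pos c) :
    b ∉ (pathReplacedComplete r ℓ).outerBoundary C := by
  intro hbN
  obtain ⟨d, hd, hdb⟩ := hbN.2
  have hcℓ : pos c ≤ ℓ := pos_le hℓ
  have interior {v w} (hw : ¬ IsHub w) (hw0 : 0 < pos w) (hwℓ : pos w < ℓ)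
      (h : (pathReplacedComplete r ℓ).Adj v w) : ¬ IsHub v := by
    intro hv
    rw [adj_of_isHub_of_not_isHub hℓ hv hw] at h
    omega
  have hdh := interior hb (by omega) (by omega) hdb
  rw [adj_of_not_isHub hℓ hdh hb] at hdb
  have ne {v w} (hv : v ∈ C) (hvh : ¬ IsHub v) (hw : ¬ IsHub w) (hwC : w ∉ C) :
      pos v ≠ pos w := fun h => hwC (eq_of_pos_eq hℓ hvh hw h ▸ hv)
  have hda := ne hd hdh ha haN.1
  have hdc := ne hd hdh hc hcN.1
  have hub : ∀ v ∈ C, ¬ IsHub v := by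
    intro v hv
    refine (mem_of_induce_connected hC {v | ¬ IsHub v ∧ pos a < pos v ∧ pos v < pos c} ?_ hd
      ⟨hdh, by omega, by omega⟩ hv).1
    rintro v hv w hw ⟨hvh, hav, hvc⟩ hvw
    have hwh := interior hvh (by omega) (by omega) hvw.symm
    rw [adj_of_not_isHub hℓ hvh hwh] at hvw
    have h1 := ne hw hwh ha haN.1
    have h2 := ne hw hwh hc hcN.1
    exact ⟨hwh, by omega, by omega⟩
  have h1 := pos_mem_Ioo hℓ hC hub ha hb haN hbN hab hd
  have h2 := pos_mem_Ioo hℓ hC hub hb hc hbN hcN hbc hd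
  exact lt_asymm h1.2 h2.1

theorem card_lt_of_subset_outerBoundary (hr : 3 ≤ r) (hℓ : 2 ≤ ℓ)
    (hC : ((pathReplacedComplete r ℓ).induce C).Connected)
    (N : Finset (Fin r ⊕ Fin (ℓ - 1)))
    (hN : ∀ a ∈ N, a ∈ (pathReplacedComplete r ℓ).outerBoundary C) : N.card < r := by
  classical
  have hsplit := N.card_filter_add_card_filter_not IsHub
  have hpath : (N.filter (¬ IsHub ·)).card ≤ 2 := by
    by_contra! h
    obtain ⟨a, b, c, ha, hb, hc, hab, hac, hbc⟩ := Finset.two_lt_card_iff.1 h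
    rw [Finset.mem_filter] at ha hb hc
    have key {x y z} (hx : x ∈ N ∧ ¬ IsHub x) (hy : y ∈ N ∧ ¬ IsHub y)
        (hz : z ∈ N ∧ ¬ IsHub z) : ¬ (pos x < pos y ∧ pos y < pos z) := fun ⟨hxy, hyz⟩ =>
      not_mem_outerBoundary_between hℓ hC hx.2 hy.2 hz.2 (hN x hx.1) (hN z hz.1) hxy hyz
        (hN y hy.1)
    have hab' : pos a ≠ pos b := fun h => hab (eq_of_pos_eq hℓ ha.2 hb.2 h)
    have hac' : pos a ≠ pos c := fun h => hac (eq_of_pos_eq hℓ ha.2 hc.2 h)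
    have hbc' : pos b ≠ pos c := fun h => hbc (eq_of_pos_eq hℓ hb.2 hc.2 h)
    have h1 := key ha hb hc
    have h2 := key ha hc hb
    have h3 := key hb ha hc
    have h4 := key hb hc ha
    have h5 := key hc ha hb
    have h6 := key hc hb ha
    omega
  let H : Finset (Fin r ⊕ Fin (ℓ - 1)) := Finset.univ.filter IsHub
  have hH : H.card = r - 2 := by
    have : H = (Finset.Ici (⟨2, by omega⟩ : Fin r)).map Function.Embedding.inl := by
      ext (i | i) <;> simp [H, IsHub, Fin.le_def]
    rw [this, Finset.card_map, Fin.card_Ici]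
  have hle : (N.filter IsHub) ⊆ H := fun a ha => by simp_all [H]
  by_cases hub : ∀ v ∈ C, ¬ IsHub v
  · rcases (N.filter IsHub).eq_empty_or_nonempty with h0 | ⟨h, hh⟩
    · rw [h0, Finset.card_empty] at hsplit
      omega
    · have : (N.filter (¬ IsHub ·)).card ≤ 1 := by
        by_contra! hlt
        obtain ⟨a, ha, b, hb, hab⟩ := Finset.one_lt_card.1 hlt
        rw [Finset.mem_filter] at ha hb hh
        obtain ⟨x, hx, hxh⟩ := (hN h hh.1).2
        have hpx := (adj_of_isHub_of_not_isHub hℓ hh.2 (hub x hx)).1 hxh.symm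
        have key {a b} (ha : a ∈ N ∧ ¬ IsHub a) (hb : b ∈ N ∧ ¬ IsHub b) :
            ¬ pos a < pos b := fun hlt => by
          have h1 := pos_mem_Ioo hℓ hC hub ha.2 hb.2 (hN a ha.1) (hN b hb.1) hlt hx
          have h2 : pos b ≤ ℓ := pos_le hℓ
          rw [Set.mem_Ioo] at h1
          omega
        exact hab (eq_of_pos_eq hℓ ha.2 hb.2
          (le_antisymm (not_lt.1 (key hb ha)) (not_lt.1 (key ha hb))))
      have := Finset.card_le_card hle
      omega
  · push Not at hub
    obtain ⟨v, hv, hvh⟩ := hub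
    have : (N.filter IsHub).card < H.card := by
      refine Finset.card_lt_card (Finset.ssubset_iff_of_subset hle |>.2 ⟨v, by simp [H, hvh], ?_⟩)
      exact fun h => (hN v (Finset.mem_filter.1 h).1).1 hv
    omega

/-- Adding an edge from a hub to an interior vertex of the path creates a star minor. -/
theorem star_isMinorOf_addEdge_of_isHub (hℓ : 2 ≤ ℓ) (ha : IsHub a) (hb : ¬ IsHub b)
    (hab : ¬ (pathReplacedComplete r ℓ).Adj a b) :
    (completeBipartiteGraph (Fin 1) (Fin r)).IsMinorOf
      ((pathReplacedComplete r ℓ).addEdge a b) := by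
  have hpos := (adj_of_isHub_of_not_isHub hℓ ha hb).not.1 hab
  rcases a with m | m
  swap
  · exact ha.elim
  rcases b with b | p
  · simp [IsHub, pos] at hpos hb
    omega
  rw [star_isMinorOf_iff]
  refine ⟨{Sum.inl m}, by simp, fun j => if j = m then Sum.inr p else Sum.inl j, ?_, ?_⟩
  · intro i j h
    dsimp only at h
    split_ifs at h <;> simp_all
  · intro j
    dsimp only
    split_ifs with h
    · exact ⟨by simp, _, rfl, addEdge_adj.2 (Or.inr ⟨rfl, by simp⟩)⟩
    · refine ⟨by simpa using h, _, rfl, addEdge_adj.2 (Or.inl ?_)⟩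
      simp [IsHub] at ha
      simp [pathReplacedComplete]
      grind

theorem connected_induce_initial_segment (hr : 3 ≤ r) (hℓ : 2 ≤ ℓ)
    {G : SimpleGraph (Fin r ⊕ Fin (ℓ - 1))} (hG : pathReplacedComplete r ℓ ≤ G) (n : ℕ) :
    (G.induce {v | ¬ IsHub v ∧ pos v ≤ n}).Connected := by
  obtain ⟨o, ho, hpo⟩ := exists_pos_eq hr hℓ (Nat.zero_le ℓ)
  rw [connected_iff_exists_forall_reachable]
  refine ⟨⟨o, ho, by omega⟩, ?_⟩
  suffices ∀ k, ∀ v (hv : v ∈ {v | ¬ IsHub v ∧ pos v ≤ n}), pos v = k →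
      (G.induce {v | ¬ IsHub v ∧ pos v ≤ n}).Reachable ⟨o, ho, by omega⟩ ⟨v, hv⟩ from
    fun ⟨v, hv⟩ => this _ v hv rfl
  intro k
  induction k with
  | zero =>
    intro v hv hk
    obtain rfl := eq_of_pos_eq hℓ ho hv.1 (hpo.trans hk.symm)
    exact Reachable.refl _
  | succ k ih =>
    intro v hv hk
    have hvℓ : pos v ≤ ℓ := pos_le hℓ
    obtain ⟨w, hw, hwk⟩ := exists_pos_eq hr hℓ (n := k) (by omega)
    have hvn := hv.2
    refine (ih w ⟨hw, by omega⟩ hwk).trans (Adj.reachable (hG ?_))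
    exact (adj_of_not_isHub hℓ hw hv.1).2 (Or.inl (by simp only [hwk, hk]))

/-- Adding a chord of the path creates a star minor. -/
theorem star_isMinorOf_addEdge_of_pos_lt (hr : 3 ≤ r) (hℓ : 2 ≤ ℓ) (ha : ¬ IsHub a)
    (hb : ¬ IsHub b) (hab : ¬ (pathReplacedComplete r ℓ).Adj a b) (hlt : pos a < pos b) :
    (completeBipartiteGraph (Fin 1) (Fin r)).IsMinorOf
      ((pathReplacedComplete r ℓ).addEdge a b) := by
  rw [adj_of_not_isHub hℓ ha hb] at hab
  have hbℓ : pos b ≤ ℓ := pos_le hℓ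
  obtain ⟨o, ho, hpo⟩ := exists_pos_eq hr hℓ (Nat.zero_le ℓ)
  obtain ⟨d, hd, hpd⟩ := exists_pos_eq hr hℓ (n := pos a + 1) (by omega)
  have hdb : d ≠ b := fun h => by rw [h] at hpd; omega
  have hub {j : Fin r} (h0 : j.val ≠ 0) (h1 : j.val ≠ 1) :
      IsHub (Sum.inl j : Fin r ⊕ Fin (ℓ - 1)) := by
    simp only [IsHub, Sum.elim_inl]
    omega
  rw [star_isMinorOf_iff]
  refine ⟨_, connected_induce_initial_segment hr hℓ le_sup_left (pos a),
    fun j => if j.val = 0 then d else if j.val = 1 then b else Sum.inl j, ?_, ?_⟩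
  · intro i j h
    dsimp only at h
    have key {j : Fin r} (h0 : j.val ≠ 0) (h1 : j.val ≠ 1) : d ≠ Sum.inl j ∧ b ≠ Sum.inl j :=
      ⟨fun h => hd (h ▸ hub h0 h1), fun h => hb (h ▸ hub h0 h1)⟩
    grind
  · intro j
    dsimp only
    split_ifs with h0 h1
    · exact ⟨fun h => by have := h.2; omega, a, ⟨ha, le_rfl⟩,
        addEdge_adj.2 (Or.inl ((adj_of_not_isHub hℓ ha hd).2 (Or.inl hpd.symm)))⟩
    · exact ⟨fun h => by have := h.2; omega, a, ⟨ha, le_rfl⟩,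
        addEdge_adj.2 (Or.inr ⟨rfl, fun h => by rw [h] at hlt; omega⟩)⟩
    · exact ⟨fun h => h.1 (hub h0 h1), o, ⟨ho, by omega⟩, addEdge_adj.2 (Or.inl
        ((adj_of_isHub_of_not_isHub hℓ (hub h0 h1) ho).2 (Or.inl hpo)).symm)⟩

end pathReplacedComplete

/-- The complete graph with one edge replaced by a long path is
`M(K_{1,r})`-saturated. -/
theorem pathReplacedComplete_star_minorSaturated (r ℓ : ℕ) (hr : 3 ≤ r) (hℓ : 2 ≤ ℓ) :
    MinorSaturated (completeBipartiteGraph (Fin 1) (Fin r)) (pathReplacedComplete r ℓ) := by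
  classical
  open pathReplacedComplete in
  refine ⟨fun h => ?_, fun u v huv hadj => ?_⟩
  · obtain ⟨C, hC, f, hf, hfC⟩ := SimpleGraph.star_isMinorOf_iff.1 h
    have := card_lt_of_subset_outerBoundary hr hℓ hC (Finset.univ.image f) (by simpa using hfC)
    rw [Finset.card_image_of_injective _ hf, Finset.card_univ, Fintype.card_fin] at this
    exact this.false
  · have hadj' : ¬ (pathReplacedComplete r ℓ).Adj v u := fun h => hadj h.symm
    by_cases hu : IsHub u <;> by_cases hv : IsHub v
    · exact absurd ((adj_of_isHub hu hv).2 huv) hadj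
    · exact star_isMinorOf_addEdge_of_isHub hℓ hu hv hadj
    · rw [SimpleGraph.addEdge_comm]
      exact star_isMinorOf_addEdge_of_isHub hℓ hv hu hadj'
    · rcases lt_trichotomy (pos u) (pos v) with hlt | heq | hlt
      · exact star_isMinorOf_addEdge_of_pos_lt hr hℓ hu hv hadj hlt
      · exact absurd (eq_of_pos_eq hℓ hu hv heq) huv
      · rw [SimpleGraph.addEdge_comm]
        exact star_isMinorOf_addEdge_of_pos_lt hr hℓ hv hu hadj' hlt
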